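/- arXiv:2302.11474 — 2 statements merged into one kernel-verified Lean document; each statement's English description precedes it below -/
import Mathlib

section
/- Let A be an m x n real matrix, b a vector in R^m, S a d x m real matrix, and delta in [0, 1). Let V = range([A b]) be the subspace of R^m spanned by the columns of A together with b. If S is a delta-embedding for V, then || A (S A)^dagger (S b) - b ||_2 <= ((1 + delta)/(1 - delta)) || A A^dagger b - b ||_2. -/
open Matrix

/-- The Euclidean (`ℓ₂`) norm of a vector. -/
noncomputable def l2norm {m : ℕ} (v : Fin m → ℝ) : ℝ :=
  Real.sqrt (∑ i, v i ^ 2)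

/-- The matrix `[A b]` obtained by appending `b` as an additional column to `A`. -/
def appendCol {m n : ℕ} (A : Matrix (Fin m) (Fin n) ℝ) (b : Fin m → ℝ) :
    Matrix (Fin m) (Fin (n + 1)) ℝ :=
  Matrix.of fun i j => if h : (j : ℕ) < n then A i ⟨(j : ℕ), h⟩ else b i

/-- `B` is the Moore–Penrose pseudoinverse of `A`. -/
def IsMoorePenrose {m n : Type*} [Fintype m] [Fintype n] (A : Matrix m n ℝ)
    (B : Matrix n m ℝ) : Prop :=
  A * B * A = A ∧ B * A * B = B ∧ (A * B)ᵀ = A * B ∧ (B * A)ᵀ = B * A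

theorem ls_opt {d n : ℕ} (M : Matrix (Fin d) (Fin n) ℝ) (P : Matrix (Fin n) (Fin d) ℝ)
    (h : IsMoorePenrose M P) (c : Fin d → ℝ) (x : Fin n → ℝ) :
    l2norm (M.mulVec (P.mulVec c) - c) ≤ l2norm (M.mulVec x - c) := by
  obtain ⟨h1, -, h3, -⟩ := h
  have hT : Mᵀ * (M * P) = Mᵀ := by
    rw [← h3, ← Matrix.transpose_mul, h1]
  have horth : ∀ z : Fin n → ℝ, (M.mulVec (P.mulVec c) - c) ⬝ᵥ (M.mulVec z) = 0 := by
    intro z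
    have h0 : Mᵀ *ᵥ (M.mulVec (P.mulVec c) - c) = 0 := by
      rw [Matrix.mulVec_sub, Matrix.mulVec_mulVec, Matrix.mulVec_mulVec, Matrix.mul_assoc, hT, sub_self]
    rw [Matrix.dotProduct_mulVec, ← Matrix.mulVec_transpose, h0, zero_dotProduct]
  have hsq : ∀ v : Fin d → ℝ, ∑ i, v i ^ 2 = v ⬝ᵥ v := by
    intro v
    simp [dotProduct, sq]
  unfold l2norm
  apply Real.sqrt_le_sqrt
  rw [hsq, hsq]
  have hdec : M.mulVec x - c = (M.mulVec (P.mulVec c) - c) + M.mulVec (x - P.mulVec c) := by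
    rw [Matrix.mulVec_sub]; abel
  have hz := horth (x - P.mulVec c)
  rw [hdec]
  generalize M.mulVec (P.mulVec c) - c = r at *
  generalize M.mulVec (x - P.mulVec c) = w at *
  have hw : 0 ≤ w ⬝ᵥ w := by
    rw [← hsq]; positivity
  rw [add_dotProduct, dotProduct_add, dotProduct_add, dotProduct_comm w r, hz]
  linarith

theorem sub_mem_range_appendCol {m n : ℕ} (A : Matrix (Fin m) (Fin n) ℝ) (b : Fin m → ℝ)
    (x : Fin n → ℝ) :
    A.mulVec x - b ∈ LinearMap.range (appendCol A b).mulVecLin := by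
  refine ⟨Fin.snoc x (-1), ?_⟩
  ext i
  simp [appendCol, Matrix.mulVec, dotProduct, Fin.sum_univ_castSucc, sub_eq_add_neg]

/-- The sketch-and-solve guarantee for overdetermined least squares: if `S` is a
`δ`-embedding for `range([A b])` with `δ ∈ [0,1)`, then
`‖A (SA)†(Sb) - b‖₂ ≤ ((1+δ)/(1-δ)) ‖A A† b - b‖₂`. -/
theorem sketch_and_solve_bound {m n d : ℕ}
    (A : Matrix (Fin m) (Fin n) ℝ) (b : Fin m → ℝ) (S : Matrix (Fin d) (Fin m) ℝ)
    (δ : ℝ) (hδ0 : 0 ≤ δ) (hδ1 : δ < 1)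
    (hemb : ∀ y ∈ LinearMap.range (appendCol A b).mulVecLin,
      (1 - δ) * l2norm y ≤ l2norm (S.mulVec y) ∧
        l2norm (S.mulVec y) ≤ (1 + δ) * l2norm y)
    (SAdag : Matrix (Fin n) (Fin d) ℝ) (hSAdag : IsMoorePenrose (S * A) SAdag)
    (Adag : Matrix (Fin n) (Fin m) ℝ) (hAdag : IsMoorePenrose A Adag) :
    l2norm (A.mulVec (SAdag.mulVec (S.mulVec b)) - b) ≤
      ((1 + δ) / (1 - δ)) * l2norm (A.mulVec (Adag.mulVec b) - b) := by
  have h1 := (hemb _ (sub_mem_range_appendCol A b (SAdag.mulVec (S.mulVec b)))).1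
  have h2 := (hemb _ (sub_mem_range_appendCol A b (Adag.mulVec b))).2
  have h3 := ls_opt (S * A) SAdag hSAdag (S.mulVec b) (Adag.mulVec b)
  have e : ∀ x, S.mulVec (A.mulVec x - b) = (S * A).mulVec x - S.mulVec b := by
    intro x
    rw [Matrix.mulVec_sub, Matrix.mulVec_mulVec]
  rw [e] at h1 h2
  rw [div_mul_eq_mul_div, le_div_iff₀ (by linarith), mul_comm]
  exact h1.trans (h3.trans h2)
end

section
/- Let A_1, ..., A_L be real matrices with A_k of size m_k x n_k and each A_k of full column rank, and let A be their Kronecker product, the (m_1 * ... * m_L) x (n_1 * ... * n_L) matrix with entries A[(i_1, ..., i_L), (j_1, ..., j_L)] = prod_{k=1}^L A_k[i_k, j_k]. Then A has full column rank, and for every row index i = (i_1, ..., i_L) the leverage scores multiply: l_i(A) = prod_{k=1}^L l_{i_k}(A_k). Consequently the leverage score distributions multiply: p_i(A) = prod_{k=1}^L p_{i_k}(A_k). -/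
open Matrix

/-- The `i`-th leverage score of `B`: `B[i,:] (BᵀB)⁻¹ B[i,:]ᵀ`. -/
noncomputable def lev {ι κ : Type*} [Fintype ι] [Fintype κ] [DecidableEq κ]
    (B : Matrix ι κ ℝ) (i : ι) : ℝ :=
  ∑ a, B i a * ((Bᵀ * B)⁻¹).mulVec (B i) a

/-- The Kronecker product of `A 1, …, A L`: rows indexed by tuples `(i₁, …, i_L)`,
columns by tuples `(j₁, …, j_L)`, with entries `∏ k, A k (i k) (j k)`. -/
def kron {L : ℕ} {m n : Fin L → ℕ}
    (A : ∀ k : Fin L, Matrix (Fin (m k)) (Fin (n k)) ℝ) :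
    Matrix (∀ k : Fin L, Fin (m k)) (∀ k : Fin L, Fin (n k)) ℝ :=
  Matrix.of fun i j => ∏ k, A k (i k) (j k)

theorem kron_mul_aux {L : ℕ} {m n p : Fin L → ℕ}
    (A : ∀ k : Fin L, Matrix (Fin (m k)) (Fin (n k)) ℝ)
    (B : ∀ k : Fin L, Matrix (Fin (n k)) (Fin (p k)) ℝ) :
    kron A * kron B = kron (fun k => A k * B k) := by
  ext i j
  simp only [kron, Matrix.mul_apply, Matrix.of_apply, Fintype.prod_sum, Finset.prod_mul_distrib]

theorem kron_one_aux {L : ℕ} (n : Fin L → ℕ) :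
    kron (fun k => (1 : Matrix (Fin (n k)) (Fin (n k)) ℝ)) = 1 := by
  ext i j
  simp only [kron, Matrix.of_apply]
  by_cases h : i = j
  · subst h
    simp
  · rw [Matrix.one_apply_ne h]
    obtain ⟨k, hk⟩ := Function.ne_iff.mp h
    exact Finset.prod_eq_zero (Finset.mem_univ k) (Matrix.one_apply_ne hk)

theorem isUnit_of_rank_aux {n : ℕ} (M : Matrix (Fin n) (Fin n) ℝ) (h : M.rank = n) :
    IsUnit M := by
  rw [← Matrix.linearIndependent_cols_iff_isUnit, linearIndependent_iff_card_eq_finrank_span,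
    Set.finrank, ← Matrix.rank_eq_finrank_span_cols, h, Fintype.card_fin]

/-- If each `A k` has full column rank, then their Kronecker product has full column
rank, its leverage scores are the products of the factors' leverage scores, and the
leverage score distributions multiply. -/
theorem kron_leverage_scores {L : ℕ} (m n : Fin L → ℕ)
    (A : ∀ k : Fin L, Matrix (Fin (m k)) (Fin (n k)) ℝ)
    (hrank : ∀ k, (A k).rank = n k) :
    (kron A).rank = ∏ k, n k ∧
    (∀ i : ∀ k : Fin L, Fin (m k), lev (kron A) i = ∏ k, lev (A k) (i k)) ∧
    (∀ i : ∀ k : Fin L, Fin (m k),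
      lev (kron A) i / (∏ k, (n k : ℝ)) = ∏ k, (lev (A k) (i k) / (n k : ℝ))) := by
  have hG : ∀ k, ((A k)ᵀ * A k) * ((A k)ᵀ * A k)⁻¹ = 1 := fun k =>
    Matrix.mul_nonsing_inv _ ((Matrix.isUnit_iff_isUnit_det _).mp
      (isUnit_of_rank_aux _ (by rw [Matrix.rank_transpose_mul_self, hrank])))
  have hT : (kron A)ᵀ = kron (fun k => (A k)ᵀ) := rfl
  have hmul : ((kron A)ᵀ * kron A) * kron (fun k => ((A k)ᵀ * A k)⁻¹) = 1 := by
    rw [hT, kron_mul_aux, kron_mul_aux]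
    simp only [hG]
    exact kron_one_aux n
  have hinv := Matrix.inv_eq_right_inv hmul
  have hlev : ∀ i : ∀ k : Fin L, Fin (m k), lev (kron A) i = ∏ k, lev (A k) (i k) := by
    intro i
    simp only [lev, hinv, Matrix.mulVec, dotProduct]
    simp only [kron, Matrix.of_apply, Fintype.prod_sum, Finset.prod_mul_distrib]
  refine ⟨?_, hlev, fun i => by rw [hlev, Finset.prod_div_distrib]⟩
  rw [← Matrix.rank_transpose_mul_self, Matrix.rank_of_isUnit _ (IsUnit.of_mul_eq_one _ hmul)]
  simp
end
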